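/- Let k₁ = 2 and 2 ≤ t ≤ min(k₂, d). If S ⊆ [2]×[k₂] contains no column slice C_j and has combinatorial type (0, v) with 1 ≤ v ≤ k₂, then I_∅ ⊊ I_S; in particular, I_S is not minimal among {I_{S'} : S' ⊆ [2]×[k₂]}. -/

import Mathlib

noncomputable section

open MvPolynomial

namespace CI

/-- The column index set `[k₁] × [k₂]`. -/
abbrev Col (k₁ k₂ : ℕ) := Fin k₁ × Fin k₂

/-- The polynomial ring `ℂ[X]` in the entries of the `d × (k₁k₂)` matrix `X` of
indeterminates `x_{i,(j,ℓ)}`. -/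
abbrev MvP (d k₁ k₂ : ℕ) := MvPolynomial (Fin d × Col k₁ k₂) ℂ

/-- The `r × r` minor of `X` with rows `a` and columns `b`. -/
def minorPoly (d k₁ k₂ r : ℕ) (a : Fin r → Fin d) (b : Fin r → Col k₁ k₂) :
    MvP d k₁ k₂ :=
  (Matrix.of fun i j => (X (a i, b j) : MvP d k₁ k₂)).det

/-- `F_r(X_U)`: the set of all `r × r` minors of the submatrix `X_U`. -/
def minorSet (d k₁ k₂ r : ℕ) (U : Set (Col k₁ k₂)) : Set (MvP d k₁ k₂) :=
  { f | ∃ a : Fin r → Fin d, ∃ b : Fin r → Col k₁ k₂,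
      Function.Injective a ∧ Function.Injective b ∧ (∀ i, b i ∈ U) ∧
      f = minorPoly d k₁ k₂ r a b }

/-- `I_r(X_U)`: the ideal generated by the `r × r` minors of `X_U`. -/
def minorIdeal (d k₁ k₂ r : ℕ) (U : Set (Col k₁ k₂)) : Ideal (MvP d k₁ k₂) :=
  Ideal.span (minorSet d k₁ k₂ r U)

/-- The row slice `R_i = {i} × [k₂]`. -/
def rowSlice (k₁ k₂ : ℕ) (i : Fin k₁) : Set (Col k₁ k₂) := { p | p.1 = i }

/-- The column slice `C_j = [k₁] × {j}`. -/
def colSlice (k₁ k₂ : ℕ) (j : Fin k₂) : Set (Col k₁ k₂) := { p | p.2 = j }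

/-- The conditional independence ideal `𝓘_C = Σ_j I_2(X_{C_j}) + Σ_i I_t(X_{R_i})`. -/
def ciIdeal (d k₁ k₂ t : ℕ) : Ideal (MvP d k₁ k₂) :=
  (⨆ j : Fin k₂, minorIdeal d k₁ k₂ 2 (colSlice k₁ k₂ j)) ⊔
    ⨆ i : Fin k₁, minorIdeal d k₁ k₂ t (rowSlice k₁ k₂ i)

/-- `I_∅ = I_t(X) + Σ_j I_2(X_{C_j})`. -/
def Iempty (d k₁ k₂ t : ℕ) : Ideal (MvP d k₁ k₂) :=
  minorIdeal d k₁ k₂ t Set.univ ⊔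
    ⨆ j : Fin k₂, minorIdeal d k₁ k₂ 2 (colSlice k₁ k₂ j)

/-! ### The case `k₁ = 2`: the ideals `I_S` -/

/-- The column slice `C_j` does not meet `S`. -/
def colOK (k₂ : ℕ) (S : Set (Col 2 k₂)) (j : Fin k₂) : Prop := ∀ i : Fin 2, (i, j) ∉ S

/-- `𝒞(S)`: the union of all column slices not meeting `S`. -/
def CSet (k₂ : ℕ) (S : Set (Col 2 k₂)) : Set (Col 2 k₂) := { p | colOK k₂ S p.2 }

/-- The condition `Z(1,S) ∖ Z(2,S) ≠ ∅` and `Z(2,S) ∖ Z(1,S) ≠ ∅` under which the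
`(t-1)`-minors are included in `F_S`. -/
def tCond (k₂ : ℕ) (S : Set (Col 2 k₂)) : Prop :=
  (∃ ℓ, ((0 : Fin 2), ℓ) ∈ S ∧ ((1 : Fin 2), ℓ) ∉ S) ∧
  (∃ ℓ, ((1 : Fin 2), ℓ) ∈ S ∧ ((0 : Fin 2), ℓ) ∉ S)

/-- The generating set `F_S` of the ideal `I_S` (for `k₁ = 2`). -/
def FSset (d k₂ t : ℕ) (S : Set (Col 2 k₂)) : Set (MvP d 2 k₂) :=
  minorSet d 2 k₂ 1 S ∪
  (⋃ j ∈ { j : Fin k₂ | colOK k₂ S j }, minorSet d 2 k₂ 2 (colSlice 2 k₂ j)) ∪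
  (⋃ _ : tCond k₂ S, minorSet d 2 k₂ (t - 1) (CSet k₂ S)) ∪
  minorSet d 2 k₂ t ((rowSlice 2 k₂ 0 \ S) ∪ CSet k₂ S) ∪
  minorSet d 2 k₂ t ((rowSlice 2 k₂ 1 \ S) ∪ CSet k₂ S)

/-- The ideal `I_S ⊆ ℂ[X]` for `S ⊆ [2] × [k₂]`, generated by `F_S`. -/
def ISIdeal (d k₂ t : ℕ) (S : Set (Col 2 k₂)) : Ideal (MvP d 2 k₂) :=
  Ideal.span (FSset d k₂ t S)

/-- `u = min(|R₁ ∩ S|, |R₂ ∩ S|)`, the first entry of the combinatorial type of `S`. -/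
def uOf (k₂ : ℕ) (S : Set (Col 2 k₂)) : ℕ :=
  min ((rowSlice 2 k₂ 0 ∩ S).ncard) ((rowSlice 2 k₂ 1 ∩ S).ncard)

/-- `v = max(|R₁ ∩ S|, |R₂ ∩ S|)`, the second entry of the combinatorial type of `S`. -/
def vOf (k₂ : ℕ) (S : Set (Col 2 k₂)) : ℕ :=
  max ((rowSlice 2 k₂ 0 ∩ S).ncard) ((rowSlice 2 k₂ 1 ∩ S).ncard)

/-- `S` contains no column slice. -/
def noColumn (k₂ : ℕ) (S : Set (Col 2 k₂)) : Prop :=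
  ∀ j : Fin k₂, ¬ colSlice 2 k₂ j ⊆ S

/-- A subset `S ⊆ [2] × [k₂]` is minimal: `S = ∅`, or `S` contains no column slice,
its combinatorial type `(u,v)` satisfies `1 ≤ u ≤ v ≤ k₂ - t + 1`, and `u + v = k₂`
in case `t = 2`. -/
def minimalSubset (k₂ t : ℕ) (S : Set (Col 2 k₂)) : Prop :=
  S = ∅ ∨ (noColumn k₂ S ∧ 1 ≤ uOf k₂ S ∧ uOf k₂ S ≤ vOf k₂ S ∧
    vOf k₂ S ≤ k₂ - t + 1 ∧ (t = 2 → uOf k₂ S + vOf k₂ S = k₂))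

/-! ### Hypergraphs and their closure -/

/-- The hypergraph `H(S)` on `[k₁] × [k₂]`: its hyperedges are (1) the singletons of
elements of `S`; (2) the 2-subsets of a column slice disjoint from `S`; (3) the
`(t-1)`-subsets of `{i,j} × (NZ(i,S) ∩ NZ(j,S))` for distinct rows `i, j` with
`Z(i,S) ∖ Z(j,S) ≠ ∅` and `Z(j,S) ∖ Z(i,S) ≠ ∅`; (4) the `t`-subsets of a row slice
disjoint from `S`. -/
def HS (k₁ k₂ t : ℕ) (S : Set (Col k₁ k₂)) : Set (Finset (Col k₁ k₂)) :=
  { e | (∃ p ∈ S, e = {p})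
      ∨ (e.card = 2 ∧ (∃ j, ∀ p ∈ e, p.2 = j) ∧ ∀ p ∈ e, p ∉ S)
      ∨ (e.card = t - 1 ∧ ∃ i j : Fin k₁, i ≠ j ∧
           (∃ ℓ, (i, ℓ) ∈ S ∧ (j, ℓ) ∉ S) ∧ (∃ ℓ, (j, ℓ) ∈ S ∧ (i, ℓ) ∉ S) ∧
           ∀ p ∈ e, (p.1 = i ∨ p.1 = j) ∧ (i, p.2) ∉ S ∧ (j, p.2) ∉ S)
      ∨ (e.card = t ∧ (∃ i, ∀ p ∈ e, p.1 = i) ∧ ∀ p ∈ e, p ∉ S) }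

/-- The closure of a hypergraph: iterate the rule "if `{a,b}` and `e` (with `a ∈ e`)
are hyperedges, then add `(e ∖ {a}) ∪ {b}`". -/
inductive HClosure {k₁ k₂ : ℕ} (H : Set (Finset (Col k₁ k₂))) :
    Finset (Col k₁ k₂) → Prop
  | base {e : Finset (Col k₁ k₂)} : e ∈ H → HClosure H e
  | step {e : Finset (Col k₁ k₂)} (a b : Col k₁ k₂) :
      a ∈ e → HClosure H {a, b} → HClosure H e → HClosure H (insert b (e.erase a))

/-- The determinantal ideal of a hypergraph: it is generated by the minors `[A|B]`
with `A ⊆ [d]`, `B` a hyperedge, and `|A| = |B|`. -/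
def hypIdeal (d k₁ k₂ : ℕ) (H : Set (Finset (Col k₁ k₂))) : Ideal (MvP d k₁ k₂) :=
  Ideal.span { f | ∃ e ∈ H, ∃ a : Fin e.card → Fin d, ∃ b : Fin e.card → Col k₁ k₂,
      Function.Injective a ∧ Function.Injective b ∧ (∀ i, b i ∈ e) ∧
      f = minorPoly d k₁ k₂ e.card a b }

/-- The ideal `I_S` associated to the closure of the hypergraph `H(S)`. -/
def ISclosure (d k₁ k₂ t : ℕ) (S : Set (Col k₁ k₂)) : Ideal (MvP d k₁ k₂) :=
  hypIdeal d k₁ k₂ { e | HClosure (HS k₁ k₂ t S) e }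

/-! ### The lexicographic monomial order -/

/-- `varLT a b` means the variable `x_a` is *larger* than `x_b` in the variable order
`x_{1,(1,1)} > x_{2,(1,1)} > ⋯ > x_{d,(1,1)} > x_{1,(2,1)} > ⋯ > x_{d,(k₁,k₂)}`,
i.e. `(ℓ, j, i)` precedes `(ℓ', j', i')` lexicographically, where `a = (i, (j, ℓ))`. -/
def varLT (d k₁ k₂ : ℕ) (a b : Fin d × Col k₁ k₂) : Prop :=
  Prod.Lex (· < ·) (Prod.Lex (· < ·) (· < ·))
    (a.2.2, (a.2.1, a.1)) (b.2.2, (b.2.1, b.1))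

/-- `m ≺ m'` in the lexicographic monomial order determined by the variable order:
at the largest variable where the exponents differ, `m` has the smaller exponent. -/
def monLT (d k₁ k₂ : ℕ) (m m' : (Fin d × Col k₁ k₂) →₀ ℕ) : Prop :=
  ∃ v, (∀ w, varLT d k₁ k₂ w v → m w = m' w) ∧ m v < m' v

/-- `m` is the `≺`-leading monomial of `f`. -/
def IsLeadMon (d k₁ k₂ : ℕ) (f : MvP d k₁ k₂) (m : (Fin d × Col k₁ k₂) →₀ ℕ) : Prop :=
  m ∈ f.support ∧ ∀ m' ∈ f.support, m' = m ∨ monLT d k₁ k₂ m' m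

/-- `G` is a Gröbner basis of `I` with respect to the lexicographic order `≺`:
`G` is contained in `I` and for every nonzero `f ∈ I` there is a `g ∈ G` whose
`≺`-leading monomial divides the `≺`-leading monomial of `f`. -/
def IsGB (d k₁ k₂ : ℕ) (G : Set (MvP d k₁ k₂)) (I : Ideal (MvP d k₁ k₂)) : Prop :=
  G ⊆ (I : Set (MvP d k₁ k₂)) ∧ ∀ f ∈ I, f ≠ 0 →
    ∃ g ∈ G, ∃ mg, IsLeadMon d k₁ k₂ g mg ∧
      ∀ mf, IsLeadMon d k₁ k₂ f mf → ∀ x, mg x ≤ mf x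

/-! ### The matrix `D_A` -/

/-- For `A ∈ ℂ^{k₂ × (k₁-1)}`, the `k₂ × (k₁k₂)` matrix `D_A`: its row `r` has entry
`1` in the column indexed by `(1, r)`, entry `A r ℓ` in the column indexed by
`(1+ℓ, r)` for `ℓ ∈ [k₁-1]`, and zeros elsewhere. -/
def DMat (k₁ k₂ : ℕ) (A : Matrix (Fin k₂) (Fin (k₁ - 1)) ℂ) :
    Matrix (Fin k₂) (Col k₁ k₂) ℂ := fun r c =>
  if c.2 = r then
    (if _h : (c.1 : ℕ) = 0 then 1
     else A r ⟨(c.1 : ℕ) - 1, by have := c.1.isLt; omega⟩)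
  else 0

end CI

namespace CI

lemma X_mem_ISIdeal {d k₂ : ℕ} (t : ℕ) {S : Set (Col 2 k₂)} (i : Fin d) {p : Col 2 k₂}
    (hp : p ∈ S) : (X (i, p) : MvP d 2 k₂) ∈ ISIdeal d k₂ t S := by
  refine Ideal.subset_span (Or.inl (Or.inl (Or.inl (Or.inl
    ⟨fun _ => i, fun _ => p, Function.injective_of_subsingleton _,
      Function.injective_of_subsingleton _, fun _ => hp, ?_⟩))))
  simp [minorPoly]

/-- A minor lies in every ideal containing all entries of one of its columns. -/
lemma minorPoly_mem_of_column_mem {d k₁ k₂ r : ℕ} {I : Ideal (MvP d k₁ k₂)}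
    (a : Fin r → Fin d) (b : Fin r → Col k₁ k₂) (j : Fin r)
    (h : ∀ i, (X (i, b j) : MvP d k₁ k₂) ∈ I) : minorPoly d k₁ k₂ r a b ∈ I := by
  rw [minorPoly, Matrix.det_apply]
  refine Ideal.sum_mem _ fun σ _ => ?_
  rw [Units.smul_def]
  exact zsmul_mem (I.mem_of_dvd (Finset.dvd_prod_of_mem _ (Finset.mem_univ j)) (h _)) _

/-- Minors of size at least two vanish when all variables are set to `1`. -/
lemma aeval_one_minorPoly {d k₁ k₂ r : ℕ} (hr : 2 ≤ r)
    (a : Fin r → Fin d) (b : Fin r → Col k₁ k₂) :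
    aeval (fun _ => (1 : ℂ)) (minorPoly d k₁ k₂ r a b) = 0 := by
  rw [minorPoly, AlgHom.map_det]
  refine Matrix.det_zero_of_row_eq (i := ⟨0, by omega⟩) (j := ⟨1, by omega⟩) (by simp) ?_
  ext j
  simp

lemma aeval_one_eq_zero_of_mem_ISIdeal_empty {d k₂ t : ℕ} (ht : 2 ≤ t) {f : MvP d 2 k₂}
    (hf : f ∈ ISIdeal d k₂ t ∅) : aeval (fun _ => (1 : ℂ)) f = 0 := by
  have hle : ISIdeal d k₂ t ∅ ≤
      RingHom.ker (aeval (fun _ => (1 : ℂ)) : MvP d 2 k₂ →ₐ[ℂ] ℂ) := by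
    refine Ideal.span_le.2 ?_
    rintro f ((((⟨a, b, _, _, hb, rfl⟩ | hf) | hf) | ⟨a, b, _, _, _, rfl⟩) |
      ⟨a, b, _, _, _, rfl⟩)
    · exact (hb 0).elim
    · simp only [Set.mem_iUnion] at hf
      obtain ⟨j, _, a, b, _, _, _, rfl⟩ := hf
      exact aeval_one_minorPoly le_rfl a b
    · simp [tCond] at hf
    · exact aeval_one_minorPoly ht a b
    · exact aeval_one_minorPoly ht a b
  exact hle hf

/-- If `S` misses a row slice, then every `t`-minor of `X` lies in `I_S`. -/
lemma minorPoly_mem_ISIdeal {d k₂ t : ℕ} {S : Set (Col 2 k₂)} {r : Fin 2}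
    (hr : ∀ ℓ, (r, ℓ) ∉ S) {a : Fin t → Fin d} {b : Fin t → Col 2 k₂}
    (ha : Function.Injective a) (hb : Function.Injective b) :
    minorPoly d 2 k₂ t a b ∈ ISIdeal d k₂ t S := by
  by_cases h : ∃ j, b j ∈ S
  · obtain ⟨j, hj⟩ := h
    exact minorPoly_mem_of_column_mem a b j fun i => X_mem_ISIdeal t i hj
  · push Not at h
    have hmem : ∀ i, b i ∈ (rowSlice 2 k₂ r \ S) ∪ CSet k₂ S := by
      intro i
      by_cases hi : (b i).1 = r
      · exact Or.inl ⟨hi, h i⟩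
      · refine Or.inr fun q => ?_
        by_cases hq : q = r
        · exact hq ▸ hr _
        · have : q = (b i).1 := by omega
          exact this ▸ h i
    apply Ideal.subset_span
    fin_cases r
    · exact Or.inl (Or.inr ⟨a, b, ha, hb, hmem, rfl⟩)
    · exact Or.inr ⟨a, b, ha, hb, hmem, rfl⟩

lemma ISIdeal_empty_le {d k₂ t : ℕ} {S : Set (Col 2 k₂)} {r : Fin 2}
    (hr : ∀ ℓ, (r, ℓ) ∉ S) : ISIdeal d k₂ t ∅ ≤ ISIdeal d k₂ t S := by
  refine Ideal.span_le.2 ?_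
  rintro f ((((⟨a, b, _, _, hb, rfl⟩ | hf) | hf) | ⟨a, b, ha, hb, _, rfl⟩) |
    ⟨a, b, ha, hb, _, rfl⟩)
  · exact (hb 0).elim
  · simp only [Set.mem_iUnion] at hf
    obtain ⟨j, _, a, b, ha, hb, hbj, rfl⟩ := hf
    by_cases h : ∃ i, b i ∈ S
    · obtain ⟨i, hi⟩ := h
      exact minorPoly_mem_of_column_mem a b i fun _ => X_mem_ISIdeal t _ hi
    · push Not at h
      refine Ideal.subset_span (Or.inl (Or.inl (Or.inl (Or.inr ?_))))
      simp only [Set.mem_iUnion]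
      refine ⟨j, fun q hq => ?_, a, b, ha, hb, hbj, rfl⟩
      have h2 (i) : (b i).2 = j := hbj i
      have hne : (b 0).1 ≠ (b 1).1 := fun h01 =>
        absurd (hb (Prod.ext h01 ((h2 0).trans (h2 1).symm))) (by simp)
      have hcases : q = (b 0).1 ∨ q = (b 1).1 := by omega
      rcases hcases with hq' | hq'
      · exact h 0 (by rwa [← Prod.mk.eta (p := b 0), ← hq', h2])
      · exact h 1 (by rwa [← Prod.mk.eta (p := b 1), ← hq', h2])
  · simp [tCond] at hf
  · exact minorPoly_mem_ISIdeal hr ha hb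
  · exact minorPoly_mem_ISIdeal hr ha hb

lemma exists_row_disjoint_of_uOf_eq_zero {k₂ : ℕ} {S : Set (Col 2 k₂)} (hu : uOf k₂ S = 0) :
    ∃ r : Fin 2, ∀ ℓ, (r, ℓ) ∉ S := by
  rcases Nat.min_eq_zero_iff.1 hu with h | h
  all_goals
    rw [Set.ncard_eq_zero (Set.toFinite _)] at h
    exact ⟨_, fun ℓ hℓ => Set.eq_empty_iff_forall_notMem.1 h (_, ℓ) ⟨rfl, hℓ⟩⟩

lemma nonempty_of_one_le_vOf {k₂ : ℕ} {S : Set (Col 2 k₂)} (hv : 1 ≤ vOf k₂ S) :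
    S.Nonempty := by
  by_contra h
  simp [Set.not_nonempty_iff_eq_empty.1 h, vOf] at hv

/-- if `S` contains no column slice and has combinatorial type
`(0, v)` with `1 ≤ v ≤ k₂`, then `I_∅ ⊊ I_S`; in particular `I_S` is not minimal
among `{I_{S'} : S' ⊆ [2]×[k₂]}`. -/
theorem Iempty_lt_of_type_zero_v
    (d k₂ t : ℕ) (ht : 2 ≤ t) (htk : t ≤ k₂) (htd : t ≤ d)
    (S : Set (Col 2 k₂)) (hcol : noColumn k₂ S)
    (hu : uOf k₂ S = 0) (hv1 : 1 ≤ vOf k₂ S) (hv2 : vOf k₂ S ≤ k₂) :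
    ISIdeal d k₂ t ∅ < ISIdeal d k₂ t S ∧
      ∃ S' : Set (Col 2 k₂), ISIdeal d k₂ t S' < ISIdeal d k₂ t S := by
  obtain ⟨r, hr⟩ := exists_row_disjoint_of_uOf_eq_zero hu
  obtain ⟨p, hp⟩ := nonempty_of_one_le_vOf hv1
  have hlt : ISIdeal d k₂ t ∅ < ISIdeal d k₂ t S := by
    refine lt_of_le_not_ge (ISIdeal_empty_le hr) fun hle => ?_
    have h := aeval_one_eq_zero_of_mem_ISIdeal_empty ht
      (hle (X_mem_ISIdeal t (⟨0, by omega⟩ : Fin d) hp))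
    simp at h
  exact ⟨hlt, ∅, hlt⟩

end CI
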